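/- Kleene stars of definite matrices and eigenspaces: Let n ≥ 1 and let A and B be definite n×n matrices over ℝ≥0, i.e. every cycle product of A and of B is at most 1 and all diagonal entries of A and B equal 1. Then A* = B* if and only if eig(A) = eig(B), where eig(M) = {x ∈ ℝ≥0ⁿ : M ⊙ x = x} is the eigenspace of M for the maximal eigenvalue 1. -/

import Mathlib

open scoped NNReal

open scoped NNReal

/-- Max-times product of matrices over `ℝ≥0`: `(M ⊙ N)_{ij} = max_k M_{ik}·N_{kj}`. -/
def mProd {n : ℕ} (A B : Matrix (Fin n) (Fin n) ℝ≥0) : Matrix (Fin n) (Fin n) ℝ≥0 :=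
  fun i j => Finset.univ.sup fun k => A i k * B k j

/-- Max-times identity matrix. -/
def mId {n : ℕ} : Matrix (Fin n) (Fin n) ℝ≥0 := fun i j => if i = j then 1 else 0

/-- Max-times matrix powers. -/
def mPow {n : ℕ} (A : Matrix (Fin n) (Fin n) ℝ≥0) : ℕ → Matrix (Fin n) (Fin n) ℝ≥0
  | 0 => mId
  | k + 1 => mProd A (mPow A k)

/-- Kleene star `A* = I ⊕ A ⊕ A² ⊕ ⋯`, entrywise `(A*)_{ij} = sup_{k≥0} (A^k)_{ij}`. -/
noncomputable def mStar {n : ℕ} (A : Matrix (Fin n) (Fin n) ℝ≥0) :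
    Matrix (Fin n) (Fin n) ℝ≥0 :=
  fun i j => ⨆ k : ℕ, mPow A k i j

/-- Every cycle product of `A` is at most `1` (i.e. `λ(A) ≤ 1`): for every cyclic
sequence of indices `i₁, …, i_k` (`k ≥ 1`), `A_{i₁i₂}·A_{i₂i₃}⋯A_{i_k i₁} ≤ 1`. -/
def CycleProdsLeOne {n : ℕ} (A : Matrix (Fin n) (Fin n) ℝ≥0) : Prop :=
  ∀ (k : ℕ) (p : Fin (k + 1) → Fin n), (∏ l : Fin (k + 1), A (p l) (p (l + 1))) ≤ 1

/-- Max-times matrix-vector product: `(M ⊙ x)_i = max_j M_{ij}·x_j`. -/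
def mMulVec {n : ℕ} (M : Matrix (Fin n) (Fin n) ℝ≥0) (x : Fin n → ℝ≥0) : Fin n → ℝ≥0 :=
  fun i => Finset.univ.sup fun j => M i j * x j

lemma cycle_walk_le {n : ℕ} {A : Matrix (Fin n) (Fin n) ℝ≥0} (hA : CycleProdsLeOne A)
    (p : ℕ → Fin n) (c : ℕ) (h : p (c + 1) = p 0) :
    ∏ l ∈ Finset.range (c + 1), A (p l) (p (l + 1)) ≤ 1 := by
  refine le_trans (le_of_eq ?_) (hA c (fun l => p l))
  rw [Finset.prod_range]
  refine Finset.prod_congr rfl fun l _ => ?_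
  rcases eq_or_ne l (Fin.last c) with rfl | hl
  · simp [h]
  · have : (l + 1 : Fin (c + 1)).val = l.val + 1 := by
      rw [Fin.val_add_one, if_neg hl]
    simp only [this]

lemma walk_bound {n : ℕ} {A : Matrix (Fin n) (Fin n) ℝ≥0} (hA : CycleProdsLeOne A)
    (M : ℝ≥0) (h1 : 1 ≤ M) (hM : ∀ i j, A i j ≤ M) (k : ℕ) :
    ∀ p : ℕ → Fin n, ∏ l ∈ Finset.range k, A (p l) (p (l + 1)) ≤ M ^ n := by
  induction k using Nat.strong_induction_on with
  | _ k ih =>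
  intro p
  rcases le_or_gt k n with hk | hk
  · calc ∏ l ∈ Finset.range k, A (p l) (p (l + 1)) ≤ ∏ l ∈ Finset.range k, M :=
          Finset.prod_le_prod' fun l _ => hM _ _
      _ = M ^ k := by simp
      _ ≤ M ^ n := pow_le_pow_right₀ h1 hk
  · obtain ⟨a, c, hac, hp⟩ : ∃ a c, a + (c + 1) ≤ k ∧ p (a + (c + 1)) = p a := by
      obtain ⟨x, y, hxy, he⟩ := Fintype.exists_ne_map_eq_of_card_lt
        (fun l : Fin k => p l) (by simpa using hk)
      have hne : x.val ≠ y.val := fun h => hxy (Fin.ext h)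
      rcases lt_or_gt_of_ne hne with h | h
      · refine ⟨x, y - x - 1, by omega, ?_⟩
        rw [he]; congr 1; omega
      · refine ⟨y, x - y - 1, by omega, ?_⟩
        rw [← he]; congr 1; omega
    obtain ⟨d, rfl⟩ := Nat.exists_eq_add_of_le hac
    set q : ℕ → Fin n := fun l => if l ≤ a then p l else p (l + (c + 1)) with hq
    have hq1 : ∀ l, l ≤ a → q l = p l := fun l hl => by simp [hq, hl]
    have hq2 : ∀ x, q (a + x) = p (a + (c + 1) + x) := by
      intro x
      rcases Nat.eq_zero_or_pos x with rfl | hx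
      · simp [hq, hp]
      · have : ¬ (a + x ≤ a) := by omega
        simp only [hq, this, if_false]
        congr 1; omega
    have hc := cycle_walk_le hA (fun l => p (a + l)) c (by simpa using hp)
    have hqq := ih (a + d) (by omega) q
    rw [Finset.prod_range_add] at hqq
    rw [Finset.prod_range_add, Finset.prod_range_add]
    have e1 : ∏ x ∈ Finset.range a, A (q x) (q (x + 1))
        = ∏ x ∈ Finset.range a, A (p x) (p (x + 1)) :=
      Finset.prod_congr rfl fun x hx => by
        have := Finset.mem_range.1 hx
        rw [hq1 x (by omega), hq1 (x + 1) (by omega)]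
    have e2 : ∏ x ∈ Finset.range d, A (q (a + x)) (q (a + x + 1))
        = ∏ x ∈ Finset.range d, A (p (a + (c + 1) + x)) (p (a + (c + 1) + x + 1)) :=
      Finset.prod_congr rfl fun x hx => by
        rw [hq2 x, add_assoc a x 1, hq2 (x + 1)]; rfl
    rw [e1, e2] at hqq
    refine le_trans ?_ hqq
    gcongr
    exact mul_le_of_le_one_right' hc

lemma exists_walk {n : ℕ} (A : Matrix (Fin n) (Fin n) ℝ≥0) (j : Fin n) (k : ℕ) :
    ∀ i, ∃ p : ℕ → Fin n, p 0 = i ∧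
      mPow A k i j ≤ ∏ l ∈ Finset.range k, A (p l) (p (l + 1)) := by
  induction k with
  | zero =>
    intro i
    refine ⟨fun _ => i, rfl, ?_⟩
    simp only [mPow, mId]
    split_ifs <;> simp
  | succ k ih =>
    intro i
    obtain ⟨m, _, hm⟩ := Finset.exists_mem_eq_sup Finset.univ ⟨i, Finset.mem_univ i⟩
      (fun m => A i m * mPow A k m j)
    obtain ⟨p, hp0, hp⟩ := ih m
    refine ⟨fun l => Nat.casesOn l i p, rfl, ?_⟩
    rw [Finset.prod_range_succ']
    simp only [mPow, mProd]
    rw [hm, mul_comm]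
    simp only [hp0]
    exact mul_le_mul' hp le_rfl

lemma mPow_bdd {n : ℕ} {A : Matrix (Fin n) (Fin n) ℝ≥0} (hA : CycleProdsLeOne A)
    (i j : Fin n) : BddAbove (Set.range fun k => mPow A k i j) := by
  set M : ℝ≥0 := 1 ⊔ Finset.univ.sup fun i => Finset.univ.sup fun j => A i j with hMdef
  have hM : ∀ i j, A i j ≤ M := fun i j =>
    le_trans (le_trans (Finset.le_sup (f := fun j => A i j) (Finset.mem_univ j))
      (Finset.le_sup (f := fun i => Finset.univ.sup fun j => A i j) (Finset.mem_univ i)))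
      le_sup_right
  refine ⟨M ^ n, ?_⟩
  rintro _ ⟨k, rfl⟩
  obtain ⟨p, _, hp⟩ := exists_walk A j k i
  exact hp.trans (walk_bound hA M le_sup_left hM k p)

lemma eig_iff {n : ℕ} {A : Matrix (Fin n) (Fin n) ℝ≥0} (hAd : ∀ i, A i i = 1)
    (x : Fin n → ℝ≥0) : mMulVec A x = x ↔ ∀ i j, A i j * x j ≤ x i := by
  constructor
  · intro h i j
    conv_rhs => rw [← h]
    exact Finset.le_sup (f := fun j => A i j * x j) (Finset.mem_univ j)
  · intro h
    funext i
    refine le_antisymm (Finset.sup_le fun j _ => h i j) ?_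
    have := Finset.le_sup (f := fun j => A i j * x j) (Finset.mem_univ i)
    rw [hAd i, one_mul] at this
    exact this

lemma mPow_mul_le {n : ℕ} {A : Matrix (Fin n) (Fin n) ℝ≥0} {x : Fin n → ℝ≥0}
    (h : ∀ i j, A i j * x j ≤ x i) (k : ℕ) : ∀ i j, mPow A k i j * x j ≤ x i := by
  induction k with
  | zero =>
    intro i j
    simp only [mPow, mId]
    split_ifs with hij
    · simp [hij]
    · simp
  | succ k ih =>
    intro i j
    obtain ⟨m, _, hm⟩ := Finset.exists_mem_eq_sup Finset.univ ⟨i, Finset.mem_univ i⟩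
      (fun m => A i m * mPow A k m j)
    simp only [mPow, mProd]
    rw [hm, mul_assoc]
    exact (mul_le_mul_right (ih m j) _).trans (h i m)

lemma mStar_mul_le {n : ℕ} {A : Matrix (Fin n) (Fin n) ℝ≥0} {x : Fin n → ℝ≥0}
    (h : ∀ i j, A i j * x j ≤ x i) (i j : Fin n) : mStar A i j * x j ≤ x i := by
  simp only [mStar]
  rw [NNReal.iSup_mul]
  exact ciSup_le fun k => mPow_mul_le h k i j

lemma le_mStar {n : ℕ} {A : Matrix (Fin n) (Fin n) ℝ≥0} (hA : CycleProdsLeOne A)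
    (i j : Fin n) : A i j ≤ mStar A i j := by
  refine le_trans ?_ (le_ciSup (mPow_bdd hA i j) 1)
  have := Finset.le_sup (f := fun m => A i m * (mId : Matrix (Fin n) (Fin n) ℝ≥0) m j)
    (Finset.mem_univ j)
  simpa [mPow, mProd, mId] using this

lemma one_le_mStar {n : ℕ} {A : Matrix (Fin n) (Fin n) ℝ≥0} (hA : CycleProdsLeOne A)
    (j : Fin n) : 1 ≤ mStar A j j := by
  refine le_trans ?_ (le_ciSup (mPow_bdd hA j j) 0)
  simp [mPow, mId]

lemma mStar_col {n : ℕ} {A : Matrix (Fin n) (Fin n) ℝ≥0} (hA : CycleProdsLeOne A)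
    (j i m : Fin n) : A i m * mStar A m j ≤ mStar A i j := by
  simp only [mStar]
  rw [NNReal.mul_iSup]
  refine ciSup_le fun k => le_trans ?_ (le_ciSup (mPow_bdd hA i j) (k + 1))
  exact Finset.le_sup (f := fun m => A i m * mPow A k m j) (Finset.mem_univ m)

lemma mStar_le_of_eig {n : ℕ} {A B : Matrix (Fin n) (Fin n) ℝ≥0}
    (hAd : ∀ i, A i i = 1) (hB : CycleProdsLeOne B) (hBd : ∀ i, B i i = 1)
    (h : ∀ x : Fin n → ℝ≥0, mMulVec B x = x → mMulVec A x = x) (i j : Fin n) :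
    mStar A i j ≤ mStar B i j := by
  have h1 := (eig_iff hAd _).1 (h (fun m => mStar B m j)
    ((eig_iff hBd _).2 fun i m => mStar_col hB j i m))
  exact (le_mul_of_one_le_right' (one_le_mStar hB j)).trans (mStar_mul_le h1 i j)

lemma eig_of_mStar {n : ℕ} {A B : Matrix (Fin n) (Fin n) ℝ≥0}
    (hAd : ∀ i, A i i = 1) (hB : CycleProdsLeOne B) (hBd : ∀ i, B i i = 1)
    (h : mStar A = mStar B) (x : Fin n → ℝ≥0) (hx : mMulVec A x = x) :
    mMulVec B x = x := by
  rw [eig_iff hBd]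
  intro i j
  have h1 := mStar_mul_le ((eig_iff hAd _).1 hx) i j
  rw [h] at h1
  exact (mul_le_mul_left (le_mStar hB i j) _).trans h1

/-- Kleene stars of definite matrices and eigenspaces: for definite matrices `A`, `B`
(all cycle products `≤ 1` and unit diagonal), `A* = B*` iff `eig(A) = eig(B)`, where
`eig(M) = {x : M ⊙ x = x}`. -/
theorem kleene_star_eq_iff_eig_eq (n : ℕ) (hn : 1 ≤ n)
    (A B : Matrix (Fin n) (Fin n) ℝ≥0)
    (hA : CycleProdsLeOne A) (hAd : ∀ i, A i i = 1)
    (hB : CycleProdsLeOne B) (hBd : ∀ i, B i i = 1) :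
    mStar A = mStar B ↔
      {x : Fin n → ℝ≥0 | mMulVec A x = x} = {x : Fin n → ℝ≥0 | mMulVec B x = x} := by
  constructor
  · intro h
    ext x
    exact ⟨eig_of_mStar hAd hB hBd h x, eig_of_mStar hBd hA hAd h.symm x⟩
  · intro h
    ext1 i j
    exact le_antisymm
      (mStar_le_of_eig hAd hB hBd (fun x hx => (Set.ext_iff.1 h x).2 hx) i j)
      (mStar_le_of_eig hBd hA hAd (fun x hx => (Set.ext_iff.1 h x).1 hx) i j)
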